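/- arXiv:1704.06655 — 3 statements merged into one kernel-verified Lean document; each statement's English description precedes it below -/
import Mathlib

section
/- Let R = {a ∈ K : |a| ≤ 1} be the valuation ring of K, 𝔪 = {a ∈ K : |a| < 1} its maximal ideal, and k = R/𝔪 the residue field. A series f ∈ K⟨υ^{1/p^∞}⟩ with Gauss norm ‖f‖ = 1 (so all its coefficients lie in R) is a unit of K⟨υ^{1/p^∞}⟩ if and only if its coefficientwise reduction modulo 𝔪 is a nonzero constant, i.e., if and only if f(0) ∉ 𝔪 and f(q) ∈ 𝔪 for all q ≠ 0. -/
open Filter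

variable {K : Type*} [NontriviallyNormedField K] [IsUltrametricDist K] [CompleteSpace K]

/-- The exponent set `D = ℤ[1/p]_{≥0} = {a/p^b : a, b ∈ ℕ}`. -/
def Dset (p : ℕ) : Set ℚ := {q | ∃ a b : ℕ, q = (a : ℚ) / (p : ℚ) ^ b}

/-- The exponent set `−D = {−a/p^b : a, b ∈ ℕ}`. -/
def negDset (p : ℕ) : Set ℚ := {q | ∃ a b : ℕ, q = -((a : ℚ) / (p : ℚ) ^ b)}

/-- The exponent set `ℤ[1/p] = {a/p^b : a ∈ ℤ, b ∈ ℕ}`. -/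
def Zpset (p : ℕ) : Set ℚ := {q | ∃ (a : ℤ) (b : ℕ), q = (a : ℚ) / (p : ℚ) ^ b}

/-- Membership in the algebra of series supported on `S` with coefficients tending to `0`. -/
def MemAlg (S : Set ℚ) (f : ℚ → K) : Prop :=
  (∀ q, q ∉ S → f q = 0) ∧ Filter.Tendsto f Filter.cofinite (nhds 0)

/-- The Gauss norm `‖f‖ = sup_q |f q|`. -/
noncomputable def gaussNorm (f : ℚ → K) : ℝ := ⨆ q : ℚ, ‖f q‖

/-- Convolution product of series. -/
noncomputable def conv (f g : ℚ → K) : ℚ → K := fun q => ∑' r : ℚ, f r * g (q - r)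

/-- The multiplicative unit: the series `1`. -/
def oneF : ℚ → K := fun q => if q = 0 then 1 else 0

/-- `υ^d`: the series supported at the single exponent `d` with coefficient `1`. -/
def upsilon (d : ℚ) : ℚ → K := fun q => if q = d then 1 else 0

/-- `f` is a unit of the algebra of series supported on `S`. -/
def IsUnitIn (S : Set ℚ) (f : ℚ → K) : Prop :=
  MemAlg S f ∧ ∃ g : ℚ → K, MemAlg S g ∧ conv f g = oneF ∧ conv g f = oneF

set_option linter.unusedSectionVars false

theorem aux_fin {f : ℚ → K} (h : Tendsto f cofinite (nhds 0)) {ε : ℝ} (hε : 0 < ε) :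
    {q | ε ≤ ‖f q‖}.Finite := by
  have h1 := (tendsto_zero_iff_norm_tendsto_zero.1 h).eventually (gt_mem_nhds hε)
  rw [eventually_cofinite] at h1
  simpa using h1

theorem aux_tend {f : ℚ → K} (h : ∀ ε : ℝ, 0 < ε → {q | ε ≤ ‖f q‖}.Finite) :
    Tendsto f cofinite (nhds 0) := by
  rw [tendsto_zero_iff_norm_tendsto_zero, Metric.tendsto_nhds]
  intro ε hε
  rw [eventually_cofinite]
  simpa using h ε hε

theorem aux_max {f : ℚ → K} (h : Tendsto f cofinite (nhds 0)) :
    ∃ a, ∀ q, ‖f q‖ ≤ ‖f a‖ := by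
  by_cases h0 : ∀ q, f q = 0
  · exact ⟨0, fun q => by simp [h0]⟩
  push Not at h0
  obtain ⟨q1, hq1⟩ := h0
  obtain ⟨a, ha, hm⟩ := Set.exists_max_image _ (fun q => ‖f q‖)
    (aux_fin h (norm_pos_iff.2 hq1)) ⟨q1, le_refl ‖f q1‖⟩
  refine ⟨a, fun q => ?_⟩
  by_cases hq : ‖f q1‖ ≤ ‖f q‖
  · exact hm q hq
  · exact (not_le.1 hq).le.trans ha

theorem aux_top {f : ℚ → K} (h : Tendsto f cofinite (nhds 0)) (h0 : f ≠ 0) :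
    ∃ a, f a ≠ 0 ∧ (∀ q, ‖f q‖ ≤ ‖f a‖) ∧ ∀ q, a < q → ‖f q‖ < ‖f a‖ := by
  obtain ⟨b, hb⟩ := aux_max h
  have hb0 : f b ≠ 0 := by
    intro hb0
    apply h0
    funext q
    simpa [hb0] using hb q
  obtain ⟨a, ha, hm⟩ := Set.exists_max_image _ (fun q : ℚ => q)
    (aux_fin h (norm_pos_iff.2 hb0)) ⟨b, le_refl ‖f b‖⟩
  have ha : ‖f b‖ ≤ ‖f a‖ := ha
  refine ⟨a, ?_, fun q => (hb q).trans ha, fun q hq => ?_⟩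
  · rw [← norm_pos_iff] at hb0 ⊢; linarith
  · by_contra hc
    exact absurd (hm q (ha.trans (not_lt.1 hc))) (not_le.2 hq)

theorem aux_term {f g : ℚ → K} (hf : Tendsto f cofinite (nhds 0))
    (hg : Tendsto g cofinite (nhds 0)) (q : ℚ) :
    Tendsto (fun r => f r * g (q - r)) cofinite (nhds 0) := by
  obtain ⟨b, hb⟩ := aux_max hg
  exact hf.zero_mul_isBoundedUnder_le
    (isBoundedUnder_of ⟨‖g b‖, fun r => hb _⟩)

theorem aux_summable {f g : ℚ → K} (hf : Tendsto f cofinite (nhds 0))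
    (hg : Tendsto g cofinite (nhds 0)) (q : ℚ) :
    Summable (fun r => f r * g (q - r)) :=
  NonarchimedeanAddGroup.summable_of_tendsto_cofinite_zero (aux_term hf hg q)

theorem aux_comm (f g : ℚ → K) : conv f g = conv g f := by
  funext q
  unfold conv
  rw [← (Equiv.subLeft q).tsum_eq]
  apply tsum_congr
  intro r
  simp [mul_comm]

theorem Dset_add {p : ℕ} (hp : p.Prime) {x y : ℚ} (hx : x ∈ Dset p) (hy : y ∈ Dset p) :
    x + y ∈ Dset p := by
  obtain ⟨a, b, rfl⟩ := hx
  obtain ⟨c, d, rfl⟩ := hy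
  have : (p : ℚ) ≠ 0 := by exact_mod_cast hp.ne_zero
  refine ⟨a * p ^ d + p ^ b * c, b + d, ?_⟩
  push_cast
  rw [pow_add]
  field_simp

theorem Dset_nonneg {p : ℕ} {x : ℚ} (hx : x ∈ Dset p) : 0 ≤ x := by
  obtain ⟨a, b, rfl⟩ := hx
  positivity

theorem aux_exists {ι : Type*} {u : ι → K} {ε : ℝ} (hε : 0 < ε) (h : ε ≤ ‖∑' i, u i‖) :
    ∃ i, ε / 2 ≤ ‖u i‖ := by
  by_contra hc
  push Not at hc
  have := IsUltrametricDist.norm_tsum_le_of_forall_le_of_nonneg (f := u) (C := ε / 2)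
    (by positivity) (fun i => (hc i).le)
  linarith

theorem aux_conv_mem {p : ℕ} (hp : p.Prime) {f g : ℚ → K} (hf : MemAlg (Dset p) f)
    (hg : MemAlg (Dset p) g) : MemAlg (Dset p) (conv f g) := by
  constructor
  · intro q hq
    unfold conv
    convert tsum_zero with r
    by_cases h1 : r ∈ Dset p
    · by_cases h2 : q - r ∈ Dset p
      · exact absurd (by simpa using Dset_add hp h1 h2) hq
      · simp [hg.1 _ h2]
    · simp [hf.1 _ h1]
  · apply aux_tend
    intro ε hε
    obtain ⟨a, ha⟩ := aux_max hf.2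
    obtain ⟨b, hb⟩ := aux_max hg.2
    set A := ‖f a‖ + 1
    set B := ‖g b‖ + 1
    have hA : 0 < A := by positivity
    have hB : 0 < B := by positivity
    refine ((aux_fin hf.2 (ε := ε / 2 / B) (by positivity)).add
      (aux_fin hg.2 (ε := ε / 2 / A) (by positivity))).subset ?_
    intro q hq
    obtain ⟨r, hr⟩ := aux_exists hε hq
    rw [norm_mul] at hr
    refine Set.mem_add.2 ⟨r, ?_, q - r, ?_, by ring⟩
    · rw [Set.mem_setOf_eq, div_le_iff₀ hB]
      refine hr.trans ?_
      gcongr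
      linarith [hb (q - r)]
    · rw [Set.mem_setOf_eq, div_le_iff₀ hA, mul_comm]
      refine hr.trans ?_
      gcongr
      linarith [ha r]

theorem aux_one_mem (p : ℕ) : MemAlg (Dset p) (oneF : ℚ → K) := by
  constructor
  · intro q hq
    have : q ≠ 0 := by
      rintro rfl
      exact hq ⟨0, 0, by simp⟩
    simp [oneF, this]
  · apply tendsto_nhds_of_eventually_eq
    rw [eventually_cofinite]
    refine (Set.finite_singleton (0 : ℚ)).subset ?_
    intro q hq
    by_contra h
    exact hq (if_neg h)

/-- iterated convolution powers -/
noncomputable def auxPow (h : ℚ → K) : ℕ → ℚ → K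
  | 0 => oneF
  | n + 1 => conv h (auxPow h n)

theorem auxPow_mem {p : ℕ} (hp : p.Prime) {h : ℚ → K} (hh : MemAlg (Dset p) h) (n : ℕ) :
    MemAlg (Dset p) (auxPow h n) := by
  induction n with
  | zero => exact aux_one_mem p
  | succ n ih => exact aux_conv_mem hp hh ih

theorem auxPow_le {h : ℚ → K} {c : ℝ} (hc : 0 ≤ c) (hh : ∀ q, ‖h q‖ ≤ c) (n : ℕ) (q : ℚ) :
    ‖auxPow h n q‖ ≤ c ^ n := by
  induction n generalizing q with
  | zero =>
    simp only [auxPow, oneF]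
    split_ifs <;> simp
  | succ n ih =>
    simp only [auxPow, conv]
    apply IsUltrametricDist.norm_tsum_le_of_forall_le_of_nonneg (by positivity)
    intro r
    rw [norm_mul, pow_succ']
    exact mul_le_mul (hh _) (ih _) (norm_nonneg _) hc

theorem aux_geom {p : ℕ} (hp : p.Prime) {h : ℚ → K} (hh : MemAlg (Dset p) h) {c : ℝ}
    (hc : 0 ≤ c) (hc1 : c < 1) (hle : ∀ q, ‖h q‖ ≤ c) :
    ∃ g : ℚ → K, MemAlg (Dset p) g ∧ ∀ q, g q = oneF q + conv h g q := by
  have hs : ∀ q, Summable (fun n => auxPow h n q) := fun q =>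
    Summable.of_norm_bounded (summable_geometric_of_lt_one hc hc1) (fun n => auxPow_le hc hle n q)
  refine ⟨fun q => ∑' n, auxPow h n q, ⟨?_, ?_⟩, ?_⟩
  · intro q hq
    convert tsum_zero with n
    exact (auxPow_mem hp hh n).1 q hq
  · apply aux_tend
    intro ε hε
    obtain ⟨N, hN⟩ := exists_pow_lt_of_lt_one (half_pos hε) hc1
    refine ((Set.finite_lt_nat N).biUnion (fun n _ =>
      aux_fin (auxPow_mem hp hh n).2 (half_pos hε))).subset ?_
    intro q hq
    obtain ⟨n, hn⟩ := aux_exists hε hq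
    simp only [Set.mem_iUnion]
    refine ⟨n, ?_, hn⟩
    by_contra hnN
    have h1 := auxPow_le hc hle n q
    have h2 := pow_le_pow_of_le_one hc hc1.le (not_lt.1 hnN)
    linarith
  · intro q
    show ∑' n, auxPow h n q = _
    rw [(hs q).tsum_eq_zero_add]
    congr 1
    simp only [auxPow, conv]
    have : ∀ r, h r * ∑' n, auxPow h n (q - r) = ∑' n, h r * auxPow h n (q - r) :=
      fun r => tsum_mul_left.symm
    simp only [this]
    refine (Summable.tsum_comm (f := fun n r => h r * auxPow h n (q - r)) ?_).symm
    apply NonarchimedeanAddGroup.summable_of_tendsto_cofinite_zero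
    rw [tendsto_zero_iff_norm_tendsto_zero, Metric.tendsto_nhds]
    intro ε hε
    rw [eventually_cofinite]
    obtain ⟨N, hN⟩ := exists_pow_lt_of_lt_one hε hc1
    refine ((Set.finite_lt_nat N).prod (aux_fin hh.2 hε)).subset ?_
    rintro ⟨n, r⟩ hnr
    simp only [Function.uncurry, norm_mul, dist_zero_right, norm_norm, Set.mem_setOf_eq,
      not_lt] at hnr
    have h1 := auxPow_le hc hle n (q - r)
    have h3 := hle r
    have h4 := norm_nonneg (h r)
    have h5 := norm_nonneg (auxPow h n (q - r))
    refine ⟨?_, ?_⟩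
    · by_contra hnN
      have h2 := pow_le_pow_of_le_one hc hc1.le (not_lt.1 hnN)
      nlinarith
    · have h2 := pow_le_one₀ hc hc1.le (n := n)
      rw [Set.mem_setOf_eq]
      nlinarith

theorem isUnit_iff_reduction_nonzero_constant (p : ℕ) (hp : p.Prime)
    (f : ℚ → K) (hf : MemAlg (Dset p) f) (hnorm : gaussNorm f = 1) :
    IsUnitIn (Dset p) f ↔ (¬ ‖f 0‖ < 1 ∧ ∀ q : ℚ, q ≠ 0 → ‖f q‖ < 1) := by
  have hf0 : f ≠ 0 := by
    rintro rfl
    simp [gaussNorm] at hnorm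
  obtain ⟨a, ha0, ha, ha'⟩ := aux_top hf.2 hf0
  have haD : a ∈ Dset p := by
    by_contra hc
    exact ha0 (hf.1 _ hc)
  have ha1 : ‖f a‖ = 1 := by
    rw [← hnorm]
    exact le_antisymm (le_ciSup (f := fun q => ‖f q‖) ⟨‖f a‖, by rintro _ ⟨q, rfl⟩; exact ha q⟩ a)
      (ciSup_le ha)
  constructor
  · rintro ⟨-, g, hg, hfg, -⟩
    have hg0 : g ≠ 0 := by
      rintro rfl
      have := congrFun hfg 0
      simp [conv, oneF] at this
    obtain ⟨b, hb0, hb, hb'⟩ := aux_top hg.2 hg0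
    have hbD : b ∈ Dset p := by
      by_contra hc
      exact hb0 (hg.1 _ hc)
    have key : a + b = 0 := by
      by_contra hab
      have h1 : ∑' r, f r * g (a + b - r) = 0 := by
        have := congrFun hfg (a + b)
        simpa [conv, oneF, hab] using this
      rw [(aux_summable hf.2 hg.2 (a + b)).tsum_eq_add_tsum_ite a] at h1
      have hpos : 0 < ‖f a * g b‖ := norm_pos_iff.2 (mul_ne_zero ha0 hb0)
      have hu : Tendsto (fun r => if r = a then 0 else f r * g (a + b - r)) cofinite (nhds 0) := by
        refine squeeze_zero_norm (fun r => ?_)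
          (tendsto_zero_iff_norm_tendsto_zero.1 (aux_term hf.2 hg.2 (a + b)))
        split_ifs
        · rw [norm_zero]; exact norm_nonneg _
        · exact le_rfl
      obtain ⟨m, hm⟩ := aux_max hu
      have h2 := IsUltrametricDist.norm_tsum_le_of_forall_le_of_nonneg (norm_nonneg _) hm
      have h3 : ‖(if m = a then 0 else f m * g (a + b - m))‖ < ‖f a * g b‖ := by
        split_ifs with hma
        · simpa using hpos
        · rw [norm_mul, norm_mul]
          have hfa := norm_pos_iff.2 ha0
          have hgb := norm_pos_iff.2 hb0
          rcases lt_or_gt_of_ne hma with hlt | hlt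
          · have h4 := hb' (a + b - m) (by linarith)
            have h5 := ha m
            nlinarith [norm_nonneg (f m), norm_nonneg (g (a + b - m))]
          · have h4 := ha' m hlt
            have h5 := hb (a + b - m)
            nlinarith [norm_nonneg (f m), norm_nonneg (g (a + b - m))]
      rw [add_sub_cancel_left] at h1
      rw [eq_neg_of_add_eq_zero_left h1, norm_neg] at h3
      exact absurd h2 (not_le.2 h3)
    have haz : a = 0 := by linarith [Dset_nonneg haD, Dset_nonneg hbD]
    subst haz
    refine ⟨by rw [ha1]; simp, fun q hq => ?_⟩
    rw [← ha1]
    rcases lt_or_gt_of_ne hq with hlt | hlt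
    · rw [hf.1 q (fun hc => absurd (Dset_nonneg hc) (not_le.2 hlt))]
      simp [ha1]
    · exact ha' q hlt
  · rintro ⟨h0, hq⟩
    have h01 : ‖f 0‖ = 1 := le_antisymm (ha1 ▸ ha 0) (not_lt.1 h0)
    have hfz : f 0 ≠ 0 := by
      rw [← norm_pos_iff, h01]; exact one_pos
    let h : ℚ → K := fun q => oneF q - (f 0)⁻¹ * f q
    have hone := aux_one_mem (K := K) p
    have hh : MemAlg (Dset p) h := by
      constructor
      · intro q hq
        simp [h, hone.1 q hq, hf.1 q hq]
      · simpa using hone.2.sub (hf.2.const_mul (f 0)⁻¹)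
    have hlt : ∀ q, ‖h q‖ < 1 := by
      intro q
      by_cases hq0 : q = 0
      · subst hq0; simp [h, oneF, hfz]
      · simpa [h, oneF, hq0, h01] using hq q hq0
    obtain ⟨m, hm⟩ := aux_max hh.2
    obtain ⟨g, hg, hgeq⟩ := aux_geom hp hh (norm_nonneg _) (hlt m) hm
    have hmul : conv f (fun q => (f 0)⁻¹ * g q) = oneF := by
      funext q
      have h1 : conv h g q = g q - conv f (fun q => (f 0)⁻¹ * g q) q := by
        have hs1 := aux_summable hone.2 hg.2 q
        have hs2 := (aux_summable hf.2 hg.2 q).mul_left (f 0)⁻¹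
        have e1 : ∑' r, oneF r * g (q - r) = g q := by
          rw [tsum_eq_single 0]
          · simp [oneF]
          · intro r hr; simp [oneF, hr]
        have e2 : conv h g q = ∑' r, (oneF r * g (q - r) - (f 0)⁻¹ * (f r * g (q - r))) := by
          apply tsum_congr; intro r; simp only [h]; ring
        rw [e2, hs1.tsum_sub hs2, e1]
        congr 1
        apply tsum_congr; intro r; ring
      have h2 := hgeq q
      rw [h1] at h2
      linear_combination h2
    refine ⟨hf, _, ⟨?_, ?_⟩, hmul, by rw [aux_comm, hmul]⟩
    · intro q hq
      simp [hg.1 q hq]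
    · simpa using hg.2.const_mul (f 0)⁻¹
end

section
/- Isomorphic transition data have the same degree: let A and A′ be m×m matrices over K⟨υ^{±1/p^∞}⟩ with A′ = V·A·U, where U is an invertible m×m matrix over the subring K⟨υ^{1/p^∞}⟩ (series supported on nonnegative exponents) whose determinant is a unit of K⟨υ^{1/p^∞}⟩, and V is an invertible m×m matrix over the subring K⟨υ^{−1/p^∞}⟩ (series supported on nonpositive exponents) whose determinant is a unit of K⟨υ^{−1/p^∞}⟩. If det A = υ^d·u for some d ∈ ℤ[1/p] and some u ∈ K⟨υ^{±1/p^∞}⟩ with |u(q)| < |u(0)| for all q ≠ 0, then det A′ = υ^d·u′ for some u′ ∈ K⟨υ^{±1/p^∞}⟩ with |u′(q)| < |u′(0)| for all q ≠ 0; in particular deg det A′ = deg det A = d. -/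
open Filter

variable {K : Type*} [NontriviallyNormedField K] [IsUltrametricDist K] [CompleteSpace K]

/-- Matrix multiplication with respect to the convolution product. -/
noncomputable def matConv {m : ℕ} (A B : Matrix (Fin m) (Fin m) (ℚ → K)) :
    Matrix (Fin m) (Fin m) (ℚ → K) :=
  Matrix.of fun i j => ∑ k : Fin m, conv (A i k) (B k j)

/-- The identity matrix for the convolution product. -/
def idMat (m : ℕ) : Matrix (Fin m) (Fin m) (ℚ → K) :=
  Matrix.of fun i j => if i = j then oneF else 0

/-- Finite product of a list of series, with respect to convolution. -/
noncomputable def convProd : List (ℚ → K) → (ℚ → K)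
  | [] => oneF
  | f :: l => conv f (convProd l)

/-- Determinant of a matrix of series, with respect to the convolution product. -/
noncomputable def convDet {m : ℕ} (A : Matrix (Fin m) (Fin m) (ℚ → K)) : ℚ → K :=
  ∑ σ : Equiv.Perm (Fin m),
    ((Equiv.Perm.sign σ : ℤˣ) : ℤ) • convProd (List.ofFn fun i => A (σ i) i)

/-- `U` is an invertible matrix over the subalgebra of series supported on `S`. -/
def MatInvertibleIn {m : ℕ} (S : Set ℚ) (U : Matrix (Fin m) (Fin m) (ℚ → K)) : Prop :=
  (∀ i j, MemAlg S (U i j)) ∧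
    ∃ U' : Matrix (Fin m) (Fin m) (ℚ → K), (∀ i j, MemAlg S (U' i j)) ∧
      matConv U U' = idMat m ∧ matConv U' U = idMat m


namespace DegDet

theorem nonarchRing : NonarchimedeanRing K where
  is_nonarchimedean := NonarchimedeanAddGroup.is_nonarchimedean

theorem summable_iff (f : ℚ → K) : Summable f ↔ Tendsto f cofinite (nhds 0) :=
  ⟨fun h => h.tendsto_cofinite_zero,
    fun h => NonarchimedeanAddGroup.summable_of_tendsto_cofinite_zero h⟩

theorem summable_pair {f g : ℚ → K} (hf : Summable f) (hg : Summable g) :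
    Summable (fun x : ℚ × ℚ => f x.2 * g (x.1 - x.2)) := by
  have : NonarchimedeanRing K := nonarchRing
  have h := hf.mul_of_nonarchimedean hg
  have hi : Function.Injective (fun x : ℚ × ℚ => (x.2, x.1 - x.2)) := by
    intro x y hxy
    have h1 : x.2 = y.2 := congrArg Prod.fst hxy
    have h2 : x.1 - x.2 = y.1 - y.2 := congrArg Prod.snd hxy
    rw [h1] at h2
    exact Prod.ext (sub_left_injective h2) h1
  have h4 := h.comp_injective hi
  simpa only [Function.comp_def] using h4

theorem summable_term {f g : ℚ → K} (hf : Summable f) (hg : Summable g) (q : ℚ) :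
    Summable (fun r : ℚ => f r * g (q - r)) :=
  (summable_pair hf hg).prod_factor q

theorem summable_conv {f g : ℚ → K} (hf : Summable f) (hg : Summable g) :
    Summable (conv f g) :=
  (summable_pair hf hg).prod

theorem conv_comm' (f g : ℚ → K) : conv f g = conv g f := by
  funext q
  unfold conv
  rw [← (Equiv.subLeft q).tsum_eq]
  refine tsum_congr fun r => ?_
  simp [mul_comm]

theorem conv_assoc' {f g h : ℚ → K} (hf : Summable f) (hg : Summable g) (hh : Summable h) :
    conv (conv f g) h = conv f (conv g h) := by
  have : NonarchimedeanRing K := nonarchRing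
  funext q
  have key : Summable (Function.uncurry fun r s : ℚ => f s * g (r - s) * h (q - r)) := by
    have h3 := (hf.mul_of_nonarchimedean hg).mul_of_nonarchimedean hh
    have hi : Function.Injective (fun x : ℚ × ℚ => ((x.2, x.1 - x.2), q - x.1)) := by
      intro x y hxy
      have h1 : x.2 = y.2 := congrArg (fun z => z.1.1) hxy
      have h2 : q - x.1 = q - y.1 := congrArg Prod.snd hxy
      exact Prod.ext (sub_right_injective h2) h1
    have h4 := h3.comp_injective hi
    simpa only [Function.comp_def, Function.uncurry_def] using h4
  have e1 : conv (conv f g) h q = ∑' r : ℚ, ∑' s : ℚ, f s * g (r - s) * h (q - r) := by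
    unfold conv
    exact tsum_congr fun r => (tsum_mul_right).symm
  have e2 : conv f (conv g h) q = ∑' s : ℚ, ∑' r : ℚ, f s * g (r - s) * h (q - r) := by
    unfold conv
    refine tsum_congr fun s => ?_
    rw [← tsum_mul_left, ← (Equiv.subRight s).tsum_eq]
    refine tsum_congr fun r => ?_
    simp [mul_assoc]
  rw [e1, e2]
  exact key.tsum_comm.symm

theorem upsilon_conv (d : ℚ) (f : ℚ → K) (q : ℚ) : conv (upsilon d) f q = f (q - d) := by
  unfold conv upsilon
  rw [tsum_eq_single d]
  · simp
  · intro b hb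
    simp [hb]

theorem summable_upsilon (d : ℚ) : Summable (upsilon d : ℚ → K) :=
  (hasSum_single d (fun b hb => by simp [upsilon, hb])).summable

theorem oneF_eq : (oneF : ℚ → K) = upsilon 0 := rfl

theorem one_conv' (f : ℚ → K) : conv oneF f = f := by
  funext q
  rw [oneF_eq, upsilon_conv, sub_zero]

theorem conv_add' {f g h : ℚ → K} (hf : Summable f) (hg : Summable g) (hh : Summable h) :
    conv f (g + h) = conv f g + conv f h := by
  funext q
  simp only [conv, Pi.add_apply, mul_add]
  exact (summable_term hf hg q).tsum_add (summable_term hf hh q)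

variable (K) in
/-- The ring of series. -/
def R : AddSubgroup (ℚ → K) where
  carrier := {f | Summable f}
  zero_mem' := summable_zero
  add_mem' := fun ha hb => Summable.add ha hb
  neg_mem' := fun ha => Summable.neg ha

noncomputable instance : Mul (R K) := ⟨fun f g => ⟨conv f.1 g.1, summable_conv f.2 g.2⟩⟩
noncomputable instance : One (R K) := ⟨⟨oneF, summable_upsilon 0⟩⟩

theorem coe_mul' (f g : R K) : ((f * g : R K) : ℚ → K) = conv f.1 g.1 := rfl
theorem coe_one' : ((1 : R K) : ℚ → K) = oneF := rfl

noncomputable instance : CommRing (R K) where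
  mul_comm f g := Subtype.ext (conv_comm' _ _)
  mul_assoc f g h := Subtype.ext (conv_assoc' f.2 g.2 h.2)
  one_mul f := Subtype.ext (one_conv' _)
  mul_one f := Subtype.ext ((conv_comm' _ _).trans (one_conv' _))
  left_distrib f g h := Subtype.ext (conv_add' f.2 g.2 h.2)
  right_distrib f g h := Subtype.ext (by
    change conv (f.1 + g.1) h.1 = conv f.1 h.1 + conv g.1 h.1
    rw [conv_comm', conv_add' h.2 f.2 g.2, conv_comm' h.1, conv_comm' h.1])
  zero_mul f := Subtype.ext (by
    change conv 0 f.1 = 0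
    funext q
    simp [conv])
  mul_zero f := Subtype.ext (by
    change conv f.1 0 = 0
    funext q
    simp [conv])
  neg_add_cancel f := neg_add_cancel f
  zsmul := fun n f => n • f
  zsmul_zero' f := zero_zsmul f
  zsmul_succ' n f := SubNegMonoid.zsmul_succ' n f
  zsmul_neg' n f := SubNegMonoid.zsmul_neg' n f
  nsmul := fun n f => n • f
  nsmul_zero f := zero_nsmul f
  nsmul_succ n f := AddMonoid.nsmul_succ n f
  sub_eq_add_neg f g := sub_eq_add_neg f g

theorem coe_sum' {ι : Type*} (s : Finset ι) (f : ι → R K) :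
    ((∑ i ∈ s, f i : R K) : ℚ → K) = ∑ i ∈ s, (f i : ℚ → K) := by
  classical
  induction s using Finset.induction_on with
  | empty => rfl
  | insert a s ha ih => rw [Finset.sum_insert ha, Finset.sum_insert ha, ← ih]; rfl

theorem coe_listProd (l : List (R K)) :
    ((l.prod : R K) : ℚ → K) = convProd (l.map (fun f : R K => f.1)) := by
  induction l with
  | nil => rfl
  | cons a l ih => rw [List.prod_cons, coe_mul', ih]; rfl

/-- Underlying matrix of series. -/
def toMat {m : ℕ} (M : Matrix (Fin m) (Fin m) (R K)) : Matrix (Fin m) (Fin m) (ℚ → K) :=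
  fun i j => (M i j).1

theorem toMat_mul {m : ℕ} (M N : Matrix (Fin m) (Fin m) (R K)) :
    toMat (M * N) = matConv (toMat M) (toMat N) := by
  funext i j
  change ((M * N) i j).1 = ∑ k : Fin m, conv _ _
  rw [Matrix.mul_apply, coe_sum']
  rfl

theorem coe_zsmul' (n : ℤ) (f : R K) : ((n • f : R K) : ℚ → K) = n • (f : ℚ → K) := rfl

theorem coe_det {m : ℕ} (M : Matrix (Fin m) (Fin m) (R K)) :
    ((M.det : R K) : ℚ → K) = convDet (toMat M) := by
  rw [Matrix.det_apply, coe_sum']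
  unfold convDet
  refine Finset.sum_congr rfl fun σ _ => ?_
  rw [Units.smul_def, coe_zsmul', ← List.prod_ofFn, coe_listProd, List.map_ofFn]
  rfl

/-- strict bound for sums -/
theorem norm_tsum_lt {F : ℚ → K} (hF : Summable F) {C : ℝ} (hC : 0 < C)
    (h : ∀ r, ‖F r‖ < C) : ‖∑' r, F r‖ < C := by
  have hfin : {r | ¬ ‖F r‖ < C / 2}.Finite := by
    have := hF.tendsto_cofinite_zero.norm
    rw [norm_zero] at this
    exact this.eventually (gt_mem_nhds (half_pos hC))
  by_cases hne : hfin.toFinset.Nonempty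
  · obtain ⟨a, ha, hmax⟩ := hfin.toFinset.exists_max_image (fun r => ‖F r‖) hne
    refine lt_of_le_of_lt
      (IsUltrametricDist.norm_tsum_le_of_forall_le (C := max (C / 2) ‖F a‖) fun r => ?_)
      (max_lt (half_lt_self hC) (h a))
    by_cases hr : ‖F r‖ < C / 2
    · exact hr.le.trans (le_max_left _ _)
    · exact (hmax r (by simpa using hr)).trans (le_max_right _ _)
  · refine lt_of_le_of_lt
      (IsUltrametricDist.norm_tsum_le_of_forall_le (C := C / 2) fun r => ?_) (half_lt_self hC)
    by_contra hr
    exact hne ⟨r, by simpa using le_of_not_ge hr⟩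

theorem norm_tsum_eq {F : ℚ → K} (hF : Summable F) (a : ℚ) (hC : 0 < ‖F a‖)
    (h : ∀ r, r ≠ a → ‖F r‖ < ‖F a‖) : ‖∑' r, F r‖ = ‖F a‖ := by
  classical
  have hs : Summable (fun n => if n = a then 0 else F n) := by
    rw [summable_iff]
    refine squeeze_zero_norm (fun n => ?_) (by simpa using hF.tendsto_cofinite_zero.norm)
    split_ifs <;> simp
  have hlt : ‖∑' n, (if n = a then 0 else F n)‖ < ‖F a‖ := by
    refine norm_tsum_lt hs hC fun r => ?_
    split_ifs with hr
    · simpa using hC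
    · exact h r hr
  rw [hF.tsum_eq_add_tsum_ite a, IsUltrametricDist.norm_add_eq_max_of_norm_ne_norm hlt.ne',
    max_eq_left hlt.le]

theorem exists_peak {f : ℚ → K} (hf : Summable f) (h0 : f ≠ 0) (s : ℚ) :
    ∃ a, 0 < ‖f a‖ ∧ (∀ q, ‖f q‖ ≤ ‖f a‖) ∧ ∀ q, s * a < s * q → ‖f q‖ < ‖f a‖ := by
  obtain ⟨q0, hq0⟩ := Function.ne_iff.1 h0
  have hpos : 0 < ‖f q0‖ := norm_pos_iff.2 hq0
  have hfin : {r | ¬ ‖f r‖ < ‖f q0‖}.Finite := by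
    have := hf.tendsto_cofinite_zero.norm
    rw [norm_zero] at this
    exact this.eventually (gt_mem_nhds hpos)
  obtain ⟨a, ha, hmax⟩ := hfin.toFinset.exists_max_image
    (fun r => toLex (‖f r‖, s * r)) ⟨q0, by simp⟩
  have ha' : ‖f q0‖ ≤ ‖f a‖ := by simpa using ha
  have key : ∀ q, ‖f q‖ < ‖f a‖ ∨ (‖f q‖ = ‖f a‖ ∧ s * q ≤ s * a) := by
    intro q
    by_cases hq : ‖f q‖ < ‖f q0‖
    · exact Or.inl (hq.trans_le ha')
    · simpa [Prod.Lex.toLex_le_toLex] using hmax q (by simpa using hq)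
  refine ⟨a, hpos.trans_le ha', fun q => ?_, fun q hq => ?_⟩
  · rcases key q with h | h
    · exact h.le
    · exact h.1.le
  · rcases key q with h | h
    · exact h
    · exact absurd h.2 (not_le.2 hq)

theorem unit_dom {f g : ℚ → K} (hf : Summable f) (hg : Summable g) (hfg : conv f g = oneF)
    (s : ℚ) (hs : s ≠ 0) (hfs : ∀ q, s * q < 0 → f q = 0) (hgs : ∀ q, s * q < 0 → g q = 0) :
    ∀ q, q ≠ 0 → ‖f q‖ < ‖f 0‖ := by
  have h1 : conv f g 0 = 1 := by rw [hfg]; simp [oneF]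
  have hf0 : f ≠ 0 := by
    rintro rfl
    simp [conv] at h1
  have hg0 : g ≠ 0 := by
    rintro rfl
    simp [conv] at h1
  obtain ⟨a, ha0, ha1, ha2⟩ := exists_peak hf hf0 s
  obtain ⟨b, hb0, hb1, hb2⟩ := exists_peak hg hg0 s
  have hC : 0 < ‖f a * g (a + b - a)‖ := by
    rw [norm_mul, add_sub_cancel_left]; positivity
  have hn : ‖conv f g (a + b)‖ = ‖f a * g (a + b - a)‖ := by
    refine norm_tsum_eq (F := fun r => f r * g (a + b - r)) (summable_term hf hg _) a hC ?_
    intro r hr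
    simp only [norm_mul, add_sub_cancel_left]
    rcases lt_or_gt_of_ne (fun h => hr (mul_left_cancel₀ hs h) : s * r ≠ s * a) with h | h
    · refine mul_lt_mul' (ha1 r) (hb2 _ ?_) (norm_nonneg _) ha0
      linarith [mul_sub s (a + b) r, mul_add s a b]
    · exact mul_lt_mul_of_lt_of_le_of_nonneg_of_pos (ha2 r h) (hb1 _) (norm_nonneg _) hb0
  have hab : a + b = 0 := by
    by_contra hab
    rw [← hn, hfg] at hC
    simp [oneF, hab] at hC
  have hsa : 0 ≤ s * a := by
    by_contra h
    rw [hfs a (not_le.1 h)] at ha0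
    simp at ha0
  have hsb : 0 ≤ s * b := by
    by_contra h
    rw [hgs b (not_le.1 h)] at hb0
    simp at hb0
  have hsum : s * a + s * b = 0 := by rw [← mul_add, hab, mul_zero]
  have ha : a = 0 := by
    have : s * a = 0 := by linarith
    exact (mul_eq_zero.1 this).resolve_left hs
  subst ha
  intro q hq
  rcases lt_or_gt_of_ne (mul_ne_zero hs hq) with h | h
  · rw [hfs q h, norm_zero]
    exact ha0
  · exact ha2 q (by simpa using h)

theorem dom_conv {f g : ℚ → K} (hf : Summable f) (hg : Summable g)
    (hf1 : ∀ q, q ≠ 0 → ‖f q‖ < ‖f 0‖) (hg1 : ∀ q, q ≠ 0 → ‖g q‖ < ‖g 0‖) :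
    ∀ q, q ≠ 0 → ‖conv f g q‖ < ‖conv f g 0‖ := by
  have hf0 : 0 < ‖f 0‖ := (norm_nonneg _).trans_lt (hf1 1 one_ne_zero)
  have hg0 : 0 < ‖g 0‖ := (norm_nonneg _).trans_lt (hg1 1 one_ne_zero)
  have hfl : ∀ q, ‖f q‖ ≤ ‖f 0‖ := fun q => by
    by_cases h : q = 0
    · rw [h]
    · exact (hf1 q h).le
  have hgl : ∀ q, ‖g q‖ ≤ ‖g 0‖ := fun q => by
    by_cases h : q = 0
    · rw [h]
    · exact (hg1 q h).le
  have hfr : ∀ q r, r ≠ 0 → ‖f r * g (q - r)‖ < ‖f 0‖ * ‖g 0‖ := fun q r hr => by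
    rw [norm_mul]
    exact mul_lt_mul_of_lt_of_le_of_nonneg_of_pos (hf1 r hr) (hgl _) (norm_nonneg _) hg0
  have h0 : ‖conv f g 0‖ = ‖f 0‖ * ‖g 0‖ := by
    have := norm_tsum_eq (F := fun r => f r * g (0 - r)) (summable_term hf hg 0) 0
      (by simp only [sub_zero, norm_mul]; positivity)
      (fun r hr => by simpa using hfr 0 r hr)
    simpa [conv] using this
  intro q hq
  rw [h0]
  refine norm_tsum_lt (summable_term hf hg q) (by positivity) fun r => ?_
  by_cases hr : r = 0
  · subst hr
    rw [norm_mul, sub_zero]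
    exact mul_lt_mul_of_pos_left (hg1 q hq) hf0
  · exact hfr q r hr

theorem Zp_add {p : ℕ} (hp : p.Prime) {x y : ℚ} (hx : x ∈ Zpset p) (hy : y ∈ Zpset p) :
    x + y ∈ Zpset p := by
  obtain ⟨a, b, rfl⟩ := hx
  obtain ⟨c, d, rfl⟩ := hy
  have : (p : ℚ) ≠ 0 := by exact_mod_cast hp.ne_zero
  refine ⟨a * p ^ d + c * p ^ b, b + d, ?_⟩
  push_cast
  rw [pow_add]
  field_simp

theorem mem_conv {p : ℕ} (hp : p.Prime) {f g : ℚ → K} (hf : MemAlg (Zpset p) f)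
    (hg : MemAlg (Zpset p) g) : MemAlg (Zpset p) (conv f g) := by
  refine ⟨fun q hq => ?_, (summable_iff _).1
    (summable_conv ((summable_iff _).2 hf.2) ((summable_iff _).2 hg.2))⟩
  unfold conv
  convert tsum_zero with r
  by_cases hr : r ∈ Zpset p
  · rw [hg.1 (q - r), mul_zero]
    intro h
    apply hq
    simpa using Zp_add hp hr h
  · rw [hf.1 r hr, zero_mul]

theorem mem_of_D {p : ℕ} {f : ℚ → K} (hf : MemAlg (Dset p) f) : MemAlg (Zpset p) f :=
  ⟨fun q hq => hf.1 q fun ⟨a, b, h⟩ => hq ⟨a, b, by simpa using h⟩, hf.2⟩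

theorem mem_of_negD {p : ℕ} {f : ℚ → K} (hf : MemAlg (negDset p) f) : MemAlg (Zpset p) f :=
  ⟨fun q hq => hf.1 q fun ⟨a, b, h⟩ => hq ⟨-a, b, by rw [h]; push_cast; ring⟩, hf.2⟩

theorem D_dom {p : ℕ} {f : ℚ → K} (hf : IsUnitIn (Dset p) f) :
    ∀ q, q ≠ 0 → ‖f q‖ < ‖f 0‖ := by
  obtain ⟨hf, g, hg, h, -⟩ := hf
  have key : ∀ q : ℚ, 1 * q < 0 → q ∉ Dset p := by
    rintro q hq ⟨a, b, rfl⟩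
    have : (0 : ℚ) ≤ (a : ℚ) / (p : ℚ) ^ b := by positivity
    linarith
  exact unit_dom ((summable_iff _).2 hf.2) ((summable_iff _).2 hg.2) h 1 one_ne_zero
    (fun q hq => hf.1 q (key q hq)) (fun q hq => hg.1 q (key q hq))

theorem negD_dom {p : ℕ} {f : ℚ → K} (hf : IsUnitIn (negDset p) f) :
    ∀ q, q ≠ 0 → ‖f q‖ < ‖f 0‖ := by
  obtain ⟨hf, g, hg, h, -⟩ := hf
  have key : ∀ q : ℚ, (-1) * q < 0 → q ∉ negDset p := by
    rintro q hq ⟨a, b, rfl⟩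
    have : (0 : ℚ) ≤ (a : ℚ) / (p : ℚ) ^ b := by positivity
    linarith
  exact unit_dom ((summable_iff _).2 hf.2) ((summable_iff _).2 hg.2) h (-1) (by norm_num)
    (fun q hq => hf.1 q (key q hq)) (fun q hq => hg.1 q (key q hq))

end DegDet

/-- isomorphic transition data have the same degree. If `A' = V·A·U` with
`U` invertible over `K⟨υ^{1/p^∞}⟩` with unit determinant and `V` invertible over
`K⟨υ^{−1/p^∞}⟩` with unit determinant, and `det A = υ^d·u` with the constant coefficient
of `u` strictly dominant, then `det A' = υ^d·u'` with the constant coefficient of `u'`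
strictly dominant; in particular `deg det A' = deg det A = d`. -/
theorem deg_det_invariant (p : ℕ) (hp : p.Prime) (m : ℕ)
    (A A' U V : Matrix (Fin m) (Fin m) (ℚ → K))
    (hA : ∀ i j, MemAlg (Zpset p) (A i j))
    (hU : MatInvertibleIn (Dset p) U) (hUdet : IsUnitIn (Dset p) (convDet U))
    (hV : MatInvertibleIn (negDset p) V) (hVdet : IsUnitIn (negDset p) (convDet V))
    (hA' : A' = matConv (matConv V A) U)
    (d : ℚ) (hd : d ∈ Zpset p) (u : ℚ → K) (hu : MemAlg (Zpset p) u)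
    (hdom : ∀ q : ℚ, q ≠ 0 → ‖u q‖ < ‖u 0‖)
    (hdet : convDet A = conv (upsilon d) u) :
    ∃ u' : ℚ → K, MemAlg (Zpset p) u' ∧ (∀ q : ℚ, q ≠ 0 → ‖u' q‖ < ‖u' 0‖) ∧
      convDet A' = conv (upsilon d) u' := by
  have sU : ∀ i j, Summable (U i j) := fun i j => (DegDet.summable_iff _).2 (hU.1 i j).2
  have sV : ∀ i j, Summable (V i j) := fun i j => (DegDet.summable_iff _).2 (hV.1 i j).2
  have sA : ∀ i j, Summable (A i j) := fun i j => (DegDet.summable_iff _).2 (hA i j).2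
  let U1 : Matrix (Fin m) (Fin m) (DegDet.R K) := fun i j => ⟨U i j, sU i j⟩
  let V1 : Matrix (Fin m) (Fin m) (DegDet.R K) := fun i j => ⟨V i j, sV i j⟩
  let A1 : Matrix (Fin m) (Fin m) (DegDet.R K) := fun i j => ⟨A i j, sA i j⟩
  have eU : (U1.det).1 = convDet U := DegDet.coe_det U1
  have eV : (V1.det).1 = convDet V := DegDet.coe_det V1
  have eA : (A1.det).1 = convDet A := DegDet.coe_det A1
  have su : Summable u := (DegDet.summable_iff _).2 hu.2
  let u1 : DegDet.R K := ⟨u, su⟩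
  let y1 : DegDet.R K := ⟨upsilon d, DegDet.summable_upsilon d⟩
  have hA1 : A1.det = y1 * u1 := Subtype.ext (eA.trans hdet)
  have hM : A' = DegDet.toMat (V1 * A1 * U1) := by
    rw [DegDet.toMat_mul, DegDet.toMat_mul]
    exact hA'
  have hfin : (V1 * A1 * U1).det = y1 * (V1.det * u1 * U1.det) := by
    rw [Matrix.det_mul, Matrix.det_mul, hA1]
    ring
  have sdU : Summable (convDet U) := (DegDet.summable_iff _).2 hUdet.1.2
  have sdV : Summable (convDet V) := (DegDet.summable_iff _).2 hVdet.1.2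
  refine ⟨conv (conv (convDet V) u) (convDet U), ?_, ?_, ?_⟩
  · exact DegDet.mem_conv hp (DegDet.mem_conv hp (DegDet.mem_of_negD hVdet.1) hu)
      (DegDet.mem_of_D hUdet.1)
  · exact DegDet.dom_conv (DegDet.summable_conv sdV su) sdU
      (DegDet.dom_conv sdV su (DegDet.negD_dom hVdet) hdom) (DegDet.D_dom hUdet)
  · rw [hM, ← DegDet.coe_det, hfin, ← eU, ← eV]
    rfl
end

section
/- There are infinitely many pairwise non-equivalent rank-2 transition matrices of degree one over K⟨υ^{±1/p^∞}⟩: for a, a′ ∈ [0,1] ∩ ℤ[1/p] with a′ ∉ {a, 1−a}, the diagonal matrices diag(υ^a, υ^{1−a}) and diag(υ^{a′}, υ^{1−a′}) are not equivalent, where two 2×2 matrices A, A′ over K⟨υ^{±1/p^∞}⟩ are called equivalent if A′ = V·A·U for some invertible 2×2 matrix U over the subring K⟨υ^{1/p^∞}⟩ and some invertible 2×2 matrix V over the subring K⟨υ^{−1/p^∞}⟩. -/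
open Filter

variable {K : Type*} [NontriviallyNormedField K] [IsUltrametricDist K] [CompleteSpace K]

theorem summable_of_memAlg {S : Set ℚ} {f : ℚ → K} (h : MemAlg S f) : Summable f :=
  NonarchimedeanAddGroup.summable_of_tendsto_cofinite_zero h.2

theorem summable_two {f g : ℚ → K} (hf : Summable f) (hg : Summable g) :
    Summable (fun x : ℚ × ℚ => f x.2 * g (x.1 - x.2)) := by
  have : NonarchimedeanRing K := ⟨NonarchimedeanAddGroup.is_nonarchimedean⟩
  have h := hf.mul_of_nonarchimedean hg
  have hi : Function.Injective (fun x : ℚ × ℚ => (x.2, x.1 - x.2)) := by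
    rintro ⟨a, b⟩ ⟨c, d⟩ h
    simp only [Prod.mk.injEq] at h ⊢
    obtain ⟨h1, h2⟩ := h
    exact ⟨by linarith only [h1, h2], h1⟩
  have h2 := h.comp_injective hi
  simp only [Function.comp_def] at h2
  exact h2

theorem summable_one {f g : ℚ → K} (hf : Summable f) (hg : Summable g) (q : ℚ) :
    Summable (fun r : ℚ => f r * g (q - r)) :=
  (summable_two hf hg).prod_factor q

theorem summable_conv {f g : ℚ → K} (hf : Summable f) (hg : Summable g) :
    Summable (conv f g) :=
  (summable_two hf hg).prod

theorem conv_assoc' {f g h : ℚ → K} (hf : Summable f) (hg : Summable g) (hh : Summable h) :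
    conv (conv f g) h = conv f (conv g h) := by
  funext q
  have h3 : Summable (fun x : ℚ × ℚ => f x.2 * g (x.1 - x.2) * h (q - x.1)) := by
    have : NonarchimedeanRing K := ⟨NonarchimedeanAddGroup.is_nonarchimedean⟩
    have h0 := (hf.mul_of_nonarchimedean hg).mul_of_nonarchimedean hh
    have hi : Function.Injective (fun x : ℚ × ℚ => ((x.2, x.1 - x.2), q - x.1)) := by
      rintro ⟨a, b⟩ ⟨c, d⟩ h
      simp only [Prod.mk.injEq] at h ⊢
      obtain ⟨⟨h1, _⟩, h2⟩ := h
      exact ⟨by linarith only [h2], h1⟩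
    have h2 := h0.comp_injective hi
    simp only [Function.comp_def] at h2
    exact h2
  have e1 : conv (conv f g) h q = ∑' r : ℚ, ∑' s : ℚ, f s * g (r - s) * h (q - r) := by
    simp only [conv, tsum_mul_right]
  have e2 : conv f (conv g h) q = ∑' s : ℚ, ∑' r : ℚ, f s * g (r - s) * h (q - r) := by
    simp only [conv, ← tsum_mul_left]
    congr 1
    funext s
    rw [← (Equiv.subRight s).tsum_eq]
    congr 1
    funext r
    simp only [Equiv.subRight_apply]
    rw [mul_assoc, show q - s - (r - s) = q - r by ring]
  rw [e1, e2]
  exact Summable.tsum_comm (f := fun s r => f s * g (r - s) * h (q - r)) h3.prod_symm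

theorem conv_add_left {f g h : ℚ → K} (hf : Summable f) (hg : Summable g) (hh : Summable h) :
    conv (f + g) h = conv f h + conv g h := by
  funext q
  simp only [conv, Pi.add_apply, add_mul]
  exact (summable_one hf hh q).tsum_add (summable_one hg hh q)

theorem conv_add_right {f g h : ℚ → K} (hf : Summable f) (hg : Summable g) (hh : Summable h) :
    conv f (g + h) = conv f g + conv f h := by
  funext q
  simp only [conv, Pi.add_apply, mul_add]
  exact (summable_one hf hg q).tsum_add (summable_one hf hh q)

theorem conv_upsilon (f : ℚ → K) (d q : ℚ) : conv f (upsilon d) q = f (q - d) := by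
  unfold conv upsilon
  rw [tsum_eq_single (q - d)]
  · simp
  · intro r hr
    rw [if_neg, mul_zero]
    intro h
    exact hr (by linarith)

theorem upsilon_conv (f : ℚ → K) (d q : ℚ) : conv (upsilon d) f q = f (q - d) := by
  unfold conv upsilon
  rw [tsum_eq_single d]
  · simp
  · intro r hr
    rw [if_neg hr, zero_mul]

theorem conv_oneF (f : ℚ → K) : conv f oneF = f := by
  funext q
  have := conv_upsilon f 0 q
  rw [sub_zero] at this
  exact this

theorem zero_conv' (f : ℚ → K) : conv 0 f = 0 := by
  funext q; simp [conv]

theorem conv_zero' (f : ℚ → K) : conv f 0 = 0 := by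
  funext q; simp [conv]

theorem summable_upsilon (d : ℚ) : Summable (upsilon d : ℚ → K) :=
  (hasSum_ite_eq d (1 : K)).summable

theorem matConv_assoc' {A B C : Matrix (Fin 2) (Fin 2) (ℚ → K)}
    (hA : ∀ i j, Summable (A i j)) (hB : ∀ i j, Summable (B i j))
    (hC : ∀ i j, Summable (C i j)) :
    matConv (matConv A B) C = matConv A (matConv B C) := by
  ext1 i j
  have hs : ∀ i j k, Summable (conv (A i j) (B j k)) :=
    fun i j k => summable_conv (hA i j) (hB j k)
  have ht : ∀ i j k, Summable (conv (B i j) (C j k)) :=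
    fun i j k => summable_conv (hB i j) (hC j k)
  simp only [matConv, Matrix.of_apply, Fin.sum_univ_two]
  rw [conv_add_left (hs _ _ _) (hs _ _ _) (hC _ _), conv_add_left (hs _ _ _) (hs _ _ _) (hC _ _),
    conv_add_right (hA _ _) (ht _ _ _) (ht _ _ _), conv_add_right (hA _ _) (ht _ _ _) (ht _ _ _)]
  simp only [conv_assoc' (hA _ _) (hB _ _) (hC _ _)]
  abel

theorem matConv_idMat (A : Matrix (Fin 2) (Fin 2) (ℚ → K)) : matConv A (idMat 2) = A := by
  ext1 i j
  fin_cases j <;> simp [matConv, idMat, Fin.sum_univ_two, conv_oneF, conv_zero']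

theorem matConv_diag (A : Matrix (Fin 2) (Fin 2) (ℚ → K)) (d : Fin 2 → ℚ → K) (i j : Fin 2) :
    matConv A (Matrix.diagonal d) i j = conv (A i j) (d j) := by
  fin_cases j <;> simp [matConv, Fin.sum_univ_two, conv_zero']

theorem diag_matConv (A : Matrix (Fin 2) (Fin 2) (ℚ → K)) (d : Fin 2 → ℚ → K) (i j : Fin 2) :
    matConv (Matrix.diagonal d) A i j = conv (d i) (A i j) := by
  fin_cases i <;> simp [matConv, Fin.sum_univ_two, zero_conv']

theorem oneF_ne_zero' : (oneF : ℚ → K) ≠ 0 := by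
  intro h
  have := congrFun h 0
  simp [oneF] at this

theorem row_ne_zero {S : Set ℚ} {V : Matrix (Fin 2) (Fin 2) (ℚ → K)} (hV : MatInvertibleIn S V)
    (i : Fin 2) (h : ∀ j, V i j = 0) : False := by
  obtain ⟨_, V', _, h1, _⟩ := hV
  have := congrFun (congrFun h1 i) i
  simp only [matConv, idMat, Matrix.of_apply, h, zero_conv', if_true, Finset.sum_const_zero] at this
  exact oneF_ne_zero' this.symm

theorem col_ne_zero {S : Set ℚ} {V : Matrix (Fin 2) (Fin 2) (ℚ → K)} (hV : MatInvertibleIn S V)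
    (j : Fin 2) (h : ∀ i, V i j = 0) : False := by
  obtain ⟨_, V', _, _, h1⟩ := hV
  have := congrFun (congrFun h1 j) j
  simp only [matConv, idMat, Matrix.of_apply, h, conv_zero', if_true, Finset.sum_const_zero] at this
  exact oneF_ne_zero' this.symm

theorem entry_zero {p : ℕ} {v w : ℚ → K} (hv : MemAlg (negDset p) v) (hw : MemAlg (Dset p) w)
    {b b' : ℚ} (hb : b < b') (h : conv v (upsilon b) = conv (upsilon b') w) : v = 0 := by
  funext q
  have h1 := congrFun h (q + b)
  rw [conv_upsilon, upsilon_conv, add_sub_cancel_right] at h1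
  by_cases hq : 0 < q
  · apply hv.1
    rintro ⟨m, n, rfl⟩
    have : (0 : ℚ) ≤ (m : ℚ) / (p : ℚ) ^ n := by positivity
    linarith
  · rw [h1]
    apply hw.1
    rintro ⟨m, n, e⟩
    have : (0 : ℚ) ≤ (m : ℚ) / (p : ℚ) ^ n := by positivity
    linarith

/-- for `a, a' ∈ [0,1] ∩ ℤ[1/p]` with `a' ∉ {a, 1 − a}`, the rank-2
degree-one transition matrices `diag(υ^a, υ^{1−a})` and `diag(υ^{a'}, υ^{1−a'})` are not
equivalent, where `A ∼ A'` iff `A' = V·A·U` for some invertible matrix `U` over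
`K⟨υ^{1/p^∞}⟩` and some invertible matrix `V` over `K⟨υ^{−1/p^∞}⟩`. -/
theorem diagonal_bundles_not_equivalent (p : ℕ) (hp : p.Prime)
    (a a' : ℚ) (ha : a ∈ Set.Icc (0 : ℚ) 1) (ha' : a' ∈ Set.Icc (0 : ℚ) 1)
    (haD : a ∈ Zpset p) (ha'D : a' ∈ Zpset p)
    (hne : a' ≠ a) (hne' : a' ≠ 1 - a) :
    ¬ ∃ U V : Matrix (Fin 2) (Fin 2) (ℚ → K),
        MatInvertibleIn (Dset p) U ∧ MatInvertibleIn (negDset p) V ∧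
        Matrix.diagonal ![upsilon a', upsilon (1 - a')] =
          matConv (matConv V (Matrix.diagonal ![upsilon a, upsilon (1 - a)])) U := by
  rintro ⟨U, V, hU, hV, h⟩
  obtain ⟨hU1, W, hW, hUW, -⟩ := hU
  have hdiag : ∀ (b c : ℚ) (i j : Fin 2),
      Summable (Matrix.diagonal ![(upsilon b : ℚ → K), upsilon c] i j) := by
    intro b c i j
    fin_cases i <;> fin_cases j <;> simp [summable_upsilon] <;> exact summable_zero
  have hVs := fun i j => summable_of_memAlg (hV.1 i j)
  have hUs := fun i j => summable_of_memAlg (hU1 i j)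
  have hWs := fun i j => summable_of_memAlg (hW i j)
  have hVA : ∀ i j, Summable
      (matConv V (Matrix.diagonal ![(upsilon a : ℚ → K), upsilon (1 - a)]) i j) := by
    intro i j
    rw [matConv_diag]
    refine summable_conv (hVs i j) ?_
    fin_cases j <;> exact summable_upsilon _
  have key : matConv V (Matrix.diagonal ![(upsilon a : ℚ → K), upsilon (1 - a)])
      = matConv (Matrix.diagonal ![(upsilon a' : ℚ → K), upsilon (1 - a')]) W := by
    rw [h, matConv_assoc' hVA hUs hWs, hUW, matConv_idMat]
  have key2 : ∀ i j, ![a, 1 - a] j < ![a', 1 - a'] i → V i j = 0 := by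
    intro i j hij
    have e := congrFun (congrFun key i) j
    rw [matConv_diag, diag_matConv] at e
    refine entry_zero (hV.1 i j) (hW i j) hij ?_
    fin_cases i <;> fin_cases j <;> exact e
  have row : ∀ i, a < ![a', 1 - a'] i → 1 - a < ![a', 1 - a'] i → False := by
    intro i h1 h2
    refine row_ne_zero hV i fun j => key2 i j ?_
    fin_cases j
    · exact h1
    · exact h2
  have col : ∀ j, ![a, 1 - a] j < a' → ![a, 1 - a] j < 1 - a' → False := by
    intro j h1 h2
    refine col_ne_zero hV j fun i => key2 i j ?_
    fin_cases i
    · exact h1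
    · exact h2
  have r0 : a < a' → 1 - a < a' → False := row 0
  have r1 : a < 1 - a' → 1 - a < 1 - a' → False := row 1
  have c0 : a < a' → a < 1 - a' → False := col 0
  have c1 : 1 - a < a' → 1 - a < 1 - a' → False := col 1
  rcases lt_or_gt_of_ne hne with h1 | h1 <;> rcases lt_or_gt_of_ne hne' with h2 | h2
  · exact r1 (by linarith) (by linarith)
  · exact c1 (by linarith) (by linarith)
  · exact c0 (by linarith) (by linarith)
  · exact r0 (by linarith) (by linarith)
end
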